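/- Let M be an automorphism-invariant module. Then the endomorphism ring End(M) is a semiregular ring, i.e., End(M)/J(End(M)) is von Neumann regular and idempotents lift modulo J(End(M)). -/

import Mathlib

/-- A submodule is essential if it intersects every nonzero submodule nontrivially. -/
def IsEssential {R M : Type*} [Ring R] [AddCommGroup M] [Module R M]
    (N : Submodule R M) : Prop :=
  ∀ K : Submodule R M, K ≠ ⊥ → N ⊓ K ≠ ⊥

section Submodules

variable {R E : Type*} [Ring R] [AddCommGroup E] [Module R E]

lemma isEssential_iff_disjoint {N : Submodule R E} :
    IsEssential N ↔ ∀ K : Submodule R E, Disjoint N K → K = ⊥ := by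
  simp only [IsEssential, disjoint_iff]
  exact forall_congr' fun K => not_imp_not

lemma IsEssential.mono {N N' : Submodule R E} (h : IsEssential N) (hle : N ≤ N') :
    IsEssential N' := by
  rw [isEssential_iff_disjoint] at h ⊢
  exact fun K hK => h K (hK.mono_left hle)

lemma IsEssential.inf {N N' : Submodule R E} (h : IsEssential N) (h' : IsEssential N') :
    IsEssential (N ⊓ N') := fun K hK => by
  rw [inf_assoc]
  exact h _ (h' K hK)

lemma isEssential_top : IsEssential (⊤ : Submodule R E) := fun K hK => by
  simpa using hK

lemma IsEssential.comap {N : Submodule R E} (h : IsEssential N) (f : Module.End R E) :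
    IsEssential (N.comap f) := by
  rw [isEssential_iff_disjoint] at h ⊢
  intro K hK
  rw [Submodule.disjoint_def] at hK
  have hmap : K.map f = ⊥ := by
    refine h _ (Submodule.disjoint_def.2 ?_)
    rintro _ hN ⟨k, hk, rfl⟩
    rw [hK k hN hk, map_zero]
  refine (Submodule.eq_bot_iff _).2 fun k hk => hK k ?_ hk
  have : f k ∈ K.map f := ⟨k, hk, rfl⟩
  rw [hmap, Submodule.mem_bot] at this
  simp [this]

lemma exists_maximal_disjoint {N D : Submodule R E} (h : Disjoint N D) :
    ∃ D', D ≤ D' ∧ Maximal (fun K => Disjoint N K) D' := by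
  refine zorn_le_nonempty₀ {K : Submodule R E | Disjoint N K} (fun c hc hchain _ _ => ?_) D h
  refine ⟨sSup c, ?_, fun z hz => le_sSup hz⟩
  exact hchain.directedOn.disjoint_sSup_right.2 fun K hK => hc hK

end Submodules

section Injective

variable {R E : Type*} [Ring R] [AddCommGroup E] [Module R E]

lemma exists_leftInverse_on (hE : Module.Injective R E) (w : Module.End R E) (P : Submodule R E)
    (hP : ∀ p ∈ P, w p = 0 → p = 0) : ∃ r : Module.End R E, ∀ p ∈ P, r (w p) = p := by
  obtain ⟨r, hr⟩ := hE.out (w ∘ₗ P.subtype)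
    ((injective_iff_map_eq_zero _).2 fun p hp => Subtype.ext (hP p.1 p.2 hp)) P.subtype
  exact ⟨r, fun p hp => hr ⟨p, hp⟩⟩

/-- Every submodule `N` of an injective module is essential in a direct summand, which can be chosen
to have a complement containing a prescribed submodule disjoint from `N`. -/
lemma exists_idempotent_hull (hE : Module.Injective R E) {N D : Submodule R E}
    (h : Disjoint N D) :
    ∃ g : Module.End R E, (∀ v, g (g v) = g v) ∧ (∀ n ∈ N, g n = n) ∧ (∀ d ∈ D, g d = 0) ∧
      ∀ K, K ≤ LinearMap.range g → Disjoint N K → K = ⊥ := by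
  obtain ⟨D', hDD', hD'⟩ := exists_maximal_disjoint h
  obtain ⟨N', hNN', hN'⟩ := exists_maximal_disjoint hD'.prop.symm
  have maxD : ∀ V, D' ≤ V → Disjoint N V → V ≤ D' := fun V hV hNV => hD'.2 hNV hV
  have hdisj : Disjoint N' D' := hN'.prop.symm
  have essN' : ∀ K, K ≤ N' → Disjoint N K → K = ⊥ := by
    intro K hK hNK
    have : D' ⊔ K ≤ D' := by
      refine maxD _ le_sup_left (Submodule.disjoint_def.2 fun n hn hn' => ?_)
      obtain ⟨d, hd, k, hk, rfl⟩ := Submodule.mem_sup.1 hn'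
      have hd0 : d = 0 := by
        refine Submodule.disjoint_def.1 hdisj d ?_ hd
        simpa using N'.sub_mem (hNN' hn) (hK hk)
      subst hd0
      simp only [zero_add] at hn ⊢
      exact Submodule.disjoint_def.1 hNK k hn hk
    exact (hdisj.mono hK (le_sup_right.trans this)).eq_bot_of_self
  obtain ⟨q, hq⟩ := hE.out (D'.mkQ ∘ₗ N'.subtype)
    ((injective_iff_map_eq_zero _).2 fun n hn => Subtype.ext
      (Submodule.disjoint_def.1 hdisj n.1 n.2 (by simpa using hn))) N'.subtype
  set g : Module.End R E := q ∘ₗ D'.mkQ with hg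
  have gN' : ∀ n ∈ N', g n = n := fun n hn => hq ⟨n, hn⟩
  have gD' : ∀ d ∈ D', g d = 0 := fun d hd => by
    simp [hg, (Submodule.Quotient.mk_eq_zero D').2 hd]
  have essRange : ∀ W, W ≤ LinearMap.range g → Disjoint N' W → W = ⊥ := by
    intro W hW hNW
    have hV : W.comap g ≤ D' := by
      refine maxD _ (fun d hd => by simp [gD' d hd]) (Submodule.disjoint_def.2 fun n hn hn' => ?_)
      rw [Submodule.mem_comap, gN' n (hNN' hn)] at hn'
      exact Submodule.disjoint_def.1 hNW n (hNN' hn) hn'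
    refine (Submodule.eq_bot_iff _).2 fun w hw => ?_
    obtain ⟨v, rfl⟩ := hW hw
    exact gD' v (hV hw)
  have hrange : LinearMap.range g ≤ N' := by
    refine hN'.2 ?_ fun n hn => ⟨n, gN' n hn⟩
    change Disjoint _ _
    rw [disjoint_iff, inf_comm]
    exact essRange _ inf_le_left (hdisj.mono_right inf_le_right)
  exact ⟨g, fun v => gN' _ (hrange ⟨v, rfl⟩), fun n hn => gN' n (hNN' hn),
    fun d hd => gD' d (hDD' hd), fun K hK hNK => essN' K (hK.trans hrange) hNK⟩

/-- The ideal of endomorphisms with essential kernel. -/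
def essentialKernelIdeal (R E : Type*) [Ring R] [AddCommGroup E] [Module R E] :
    TwoSidedIdeal (Module.End R E) :=
  TwoSidedIdeal.mk' {s | IsEssential (LinearMap.ker s)}
    (by simpa using isEssential_top)
    (fun {x y} hx hy => (IsEssential.inf hx hy).mono fun v hv => by
      obtain ⟨h1, h2⟩ := hv
      simp_all)
    (fun {x} hx => IsEssential.mono hx fun v hv => by simp_all)
    (fun {x y} hy => IsEssential.mono hy fun v hv => by simp_all)
    (fun {x y} hx => (IsEssential.comap hx y).mono fun v hv => by simp_all)

lemma mem_essentialKernelIdeal {s : Module.End R E} :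
    s ∈ essentialKernelIdeal R E ↔ IsEssential (LinearMap.ker s) :=
  TwoSidedIdeal.mem_mk' ..

/-- An endomorphism vanishing on `N` and on the kernel of an idempotent `g` has essential kernel,
provided that `N` is essential in the range of `g`. -/
lemma mem_essentialKernelIdeal_of_hull {g s : Module.End R E} {N : Submodule R E}
    (hg : ∀ v, g (g v) = g v) (hess : ∀ K, K ≤ LinearMap.range g → Disjoint N K → K = ⊥)
    (hN : ∀ n ∈ N, s n = 0) (hker : ∀ v, g v = 0 → s v = 0) :
    s ∈ essentialKernelIdeal R E := by
  have hs : ∀ v, s v = s (g v) := fun v => by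
    have := hker (v - g v) (by simp [hg])
    rwa [map_sub, sub_eq_zero] at this
  rw [mem_essentialKernelIdeal, isEssential_iff_disjoint]
  intro K hK
  rw [Submodule.disjoint_def] at hK
  have hmap : K.map g = ⊥ := by
    refine hess _ (by rintro _ ⟨v, -, rfl⟩; exact ⟨v, rfl⟩) (Submodule.disjoint_def.2 ?_)
    rintro _ hn ⟨k, hk, rfl⟩
    rw [hK k (by rw [LinearMap.mem_ker, hs, hN _ hn]) hk, map_zero]
  refine (Submodule.eq_bot_iff _).2 fun k hk => hK k (hker k ?_) hk
  have : g k ∈ K.map g := ⟨k, hk, rfl⟩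
  rwa [hmap, Submodule.mem_bot] at this

lemma apply_apply_eq_of_leftInverse {w r : Module.End R E} (hrw : ∀ v, r (w v) = v)
    (hr : LinearMap.ker r = ⊥) : ∀ v, w (r v) = v := fun v => by
  have : w (r v) - v ∈ LinearMap.ker r := by simp [hrw]
  rwa [hr, Submodule.mem_bot, sub_eq_zero] at this

lemma isUnit_one_sub_of_mem_essentialKernelIdeal (hE : Module.Injective R E)
    {s : Module.End R E} (hs : s ∈ essentialKernelIdeal R E) : IsUnit (1 - s) := by
  rw [mem_essentialKernelIdeal, isEssential_iff_disjoint] at hs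
  have hinj : LinearMap.ker (1 - s) = ⊥ := by
    refine hs _ (Submodule.disjoint_def.2 fun v hv hv' => ?_)
    simp_all
  obtain ⟨r, hr⟩ := exists_leftInverse_on hE (1 - s) ⊤ fun p _ hp => by
    rwa [← LinearMap.mem_ker, hinj, Submodule.mem_bot] at hp
  have hrker : LinearMap.ker r = ⊥ := by
    refine hs _ (Submodule.disjoint_def.2 fun v hv hv' => ?_)
    have := hr v trivial
    simp_all
  exact ⟨⟨1 - s, r, LinearMap.ext (apply_apply_eq_of_leftInverse (fun v => hr v trivial) hrker),
    LinearMap.ext fun v => hr v trivial⟩, rfl⟩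

/-- The endomorphism ring of an injective module is von Neumann regular modulo the endomorphisms
with essential kernel. -/
lemma exists_mul_mul_sub_mem_essentialKernelIdeal (hE : Module.Injective R E)
    (y : Module.End R E) : ∃ s, y * s * y - y ∈ essentialKernelIdeal R E := by
  obtain ⟨g, hg, gN, -, hess⟩ :=
    exists_idempotent_hull hE (N := LinearMap.ker y) (D := ⊥) disjoint_bot_right
  obtain ⟨s, hs⟩ := exists_leftInverse_on hE y (LinearMap.ker g) fun p hp hyp => by
    rw [← gN p hyp]; exact hp
  refine ⟨s, mem_essentialKernelIdeal_of_hull hg hess (fun n hn => ?_) fun v hv => ?_⟩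
  · simp_all
  · simp [hs v hv]

lemma exists_idempotent_sub_mem_essentialKernelIdeal (hE : Module.Injective R E)
    {a : Module.End R E} (ha : a * a - a ∈ essentialKernelIdeal R E) :
    ∃ g : Module.End R E, g * g = g ∧ g - a ∈ essentialKernelIdeal R E := by
  rw [mem_essentialKernelIdeal] at ha
  set K := LinearMap.ker (a * a - a) with hK
  have hKa : ∀ k ∈ K, a (a k) = a k := fun k hk => by
    simpa [hK, sub_eq_zero] using hk
  have hdisj : Disjoint (K.map a) (K.map (1 - a)) := by
    rw [Submodule.disjoint_def]
    rintro _ ⟨k, hk, rfl⟩ ⟨l, hl, h⟩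
    rw [← hKa k hk, ← h]
    simp [hKa l hl]
  obtain ⟨g, hg, gN, gD, -⟩ := exists_idempotent_hull hE hdisj
  refine ⟨g, LinearMap.ext hg, mem_essentialKernelIdeal.2 (ha.mono fun k hk => ?_)⟩
  have h1 := gN _ ⟨k, hk, rfl⟩
  have h2 := gD _ ⟨k, hk, rfl⟩
  rw [LinearMap.sub_apply, Module.End.one_apply, map_sub, sub_eq_zero, h1] at h2
  simp [h2]

end Injective

section Conductor

variable {S : Type*} [Ring S]

/-- The largest two-sided ideal of `S` contained in the subring `A`. -/
def Subring.conductor (A : Subring S) : TwoSidedIdeal S :=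
  TwoSidedIdeal.mk' {t | ∀ s s', s * t * s' ∈ A}
    (fun s s' => by simp [A.zero_mem])
    (fun {x y} hx hy s s' => by
      rw [mul_add, add_mul]; exact A.add_mem (hx s s') (hy s s'))
    (fun {x} hx s s' => by
      rw [mul_neg, neg_mul]; exact A.neg_mem (hx s s'))
    (fun {x y} hy s s' => by rw [← mul_assoc]; exact hy _ _)
    (fun {x y} hx s s' => by rw [← mul_assoc, mul_assoc]; exact hx _ _)

lemma Subring.mem_conductor {A : Subring S} {t : S} :
    t ∈ A.conductor ↔ ∀ s s', s * t * s' ∈ A :=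
  TwoSidedIdeal.mem_mk' ..

lemma Subring.mem_of_mem_conductor {A : Subring S} {t : S} (h : t ∈ A.conductor) : t ∈ A := by
  simpa using Subring.mem_conductor.1 h 1 1

lemma Subring.mem_of_mul_self_eq_zero {A : Subring S} (hA : ∀ u : Sˣ, (u : S) ∈ A) {z : S}
    (hz : z * z = 0) : z ∈ A := by
  have := A.sub_mem (hA ⟨1 + z, 1 - z, by noncomm_ring; simp [hz], by noncomm_ring; simp [hz]⟩)
    A.one_mem
  simpa using this

/-- A subring containing all units contains the ideal generated by `(1 - e) * s * e`, for every
idempotent `e`. -/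
lemma Subring.mem_conductor_of_idempotent {A : Subring S} (hA : ∀ u : Sˣ, (u : S) ∈ A) {e n : S}
    (he : e * e = e) (hne : n * e = n) (hen : e * n = 0) : n ∈ A.conductor := by
  have he' : e * (1 - e) = 0 := by rw [mul_sub, he, mul_one, sub_self]
  have he'' : (1 - e) * e = 0 := by rw [sub_mul, he, one_mul, sub_self]
  have offDiag : ∀ s, e * s * (1 - e) ∈ A := fun s => Subring.mem_of_mul_self_eq_zero hA (by
    rw [show e * s * (1 - e) * (e * s * (1 - e)) = e * s * ((1 - e) * e) * s * (1 - e) by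
      simp only [mul_assoc], he'']; simp)
  have offDiag' : ∀ s, (1 - e) * s * e ∈ A := fun s => Subring.mem_of_mul_self_eq_zero hA (by
    rw [show (1 - e) * s * e * ((1 - e) * s * e) = (1 - e) * s * (e * (1 - e)) * s * e by
      simp only [mul_assoc], he']; simp)
  have hn : (1 - e) * n * e = n := by rw [mul_assoc, hne, sub_mul, one_mul, hen, sub_zero]
  have hne' : n * (1 - e) = 0 := by rw [mul_sub, hne, mul_one, sub_self]
  refine Subring.mem_conductor.2 fun s t => ?_
  have hidem : (1 - e) * (1 - e) = 1 - e := by rw [sub_mul, he', one_mul, sub_zero]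
  have key : s * n * t = (1 - e) * (s * n * t) * e + e * (s * n * t) * (1 - e)
      + (e * s * (1 - e)) * ((1 - e) * (n * t) * e)
      + ((1 - e) * (s * n) * e) * (e * t * (1 - e)) := by
    have h1 : (e * s * (1 - e)) * ((1 - e) * (n * t) * e) = e * (s * n * t) * e := by
      rw [show (e * s * (1 - e)) * ((1 - e) * (n * t) * e)
        = e * s * ((1 - e) * (1 - e) * n) * t * e by simp only [mul_assoc], hidem,
        sub_mul, one_mul, hen, sub_zero]
      simp only [mul_assoc]
    have h2 : ((1 - e) * (s * n) * e) * (e * t * (1 - e)) = (1 - e) * (s * n * t) * (1 - e) := by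
      rw [show ((1 - e) * (s * n) * e) * (e * t * (1 - e))
        = (1 - e) * s * (n * (e * e)) * t * (1 - e) by simp only [mul_assoc], he, hne]
      simp only [mul_assoc]
    rw [h1, h2]
    noncomm_ring
  rw [key]
  exact A.add_mem (A.add_mem (A.add_mem (offDiag' _) (offDiag _))
    (A.mul_mem (offDiag _) (offDiag' _))) (A.mul_mem (offDiag' _) (offDiag _))

end Conductor

section Injective

variable {R E : Type*} [Ring R] [AddCommGroup E] [Module R E]

/-- If the kernel of the idempotent `x` has no two disjoint nonzero isomorphic submodules, then every
endomorphism supported on this kernel is unit-regular modulo the endomorphisms with essential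
kernel. -/
lemma exists_unit_mul_mul_sub_mem_essentialKernelIdeal (hE : Module.Injective R E)
    {x c : Module.End R E} (hx : ∀ v, x (x v) = x v) (hcx : ∀ v, c (x v) = 0)
    (hxc : ∀ v, x (c v) = 0)
    (habel : ∀ (P : Submodule R E) (h : Module.End R E), (∀ p ∈ P, x p = 0) →
      (∀ p ∈ P, x (h p) = 0) → (∀ p ∈ P, h p = 0 → p = 0) → Disjoint P (P.map h) → P = ⊥) :
    ∃ u : (Module.End R E)ˣ, c * u * c - c ∈ essentialKernelIdeal R E := by
  obtain ⟨g, hg, gN, -, hess⟩ :=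
    exists_idempotent_hull hE (N := LinearMap.ker c) (D := ⊥) disjoint_bot_right
  have hgx : ∀ v, g (x v) = x v := fun v => gN _ (hcx v)
  have hcg : ∀ v, c v = 0 → g v = 0 → v = 0 := fun v h h' => by rw [← gN v h, h']
  have hdisj : (LinearMap.ker g).map c ⊓ LinearMap.range g = ⊥ := by
    refine hess _ inf_le_right (Submodule.disjoint_def.2 ?_)
    rintro _ hcp ⟨⟨p, hp, rfl⟩, -⟩
    let P := ((LinearMap.ker c).comap c ⊓ LinearMap.ker g).map (1 - x)
    have hPinj : ∀ p ∈ P, c p = 0 → p = 0 := by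
      rintro _ ⟨q, ⟨hq1, hq2⟩, rfl⟩ hq
      have : q = 0 := hcg q (by simpa [hcx] using hq) hq2
      simp [this]
    have hP : P = ⊥ := by
      refine habel P c ?_ (fun p _ => hxc p) hPinj (Submodule.disjoint_def.2 ?_)
      · rintro _ ⟨q, -, rfl⟩
        simp [hx]
      · rintro _ hq ⟨_, ⟨q', ⟨hq1, hq2⟩, rfl⟩, rfl⟩
        refine hPinj _ hq ?_
        simpa [hcx] using hq1
    have hmem : (1 - x) p ∈ P := ⟨p, ⟨hcp, hp⟩, rfl⟩
    rw [hP, Submodule.mem_bot] at hmem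
    have : c ((1 - x) p) = c p := by simp [hcx]
    rw [← this, hmem, map_zero]
  let w : Module.End R E := c * (1 - g) + g
  have hw : ∀ v, w v = c (v - g v) + g v := fun v => rfl
  have hwx : ∀ v, w (x v) = x v := fun v => by simp [hw, hgx]
  have hinj : ∀ v, w v = 0 → v = 0 := by
    intro v hv
    have hmem : c (v - g v) ∈ (LinearMap.ker g).map c ⊓ LinearMap.range g := by
      refine ⟨⟨v - g v, by simp [hg], rfl⟩, ⟨-v, ?_⟩⟩
      rw [map_neg, eq_comm, eq_neg_iff_add_eq_zero]
      exact hv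
    rw [hdisj, Submodule.mem_bot] at hmem
    have hgv : g v = 0 := by rw [hw, hmem, zero_add] at hv; exact hv
    rw [hgv, sub_zero] at hmem
    exact hcg v hmem hgv
  obtain ⟨r, hr⟩ := exists_leftInverse_on hE w ⊤ fun p _ hp => hinj p hp
  replace hr : ∀ v, r (w v) = v := fun v => hr v trivial
  have hrker : LinearMap.ker r = ⊥ := by
    have hrx : ∀ v, r (x v) = x v := fun v => by rw [← hwx, hr, hwx]
    have hP : (LinearMap.ker r).map (1 - x) = ⊥ := by
      refine habel _ ((1 - x) * w) ?_ ?_ ?_ (Submodule.disjoint_def.2 ?_)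
      · rintro _ ⟨q, -, rfl⟩
        simp [hx]
      · intro p _
        simp [hx]
      · rintro _ ⟨q, -, rfl⟩ hq
        set p := (1 - x) q with hp
        have hxp : x p = 0 := by simp [hp, hx]
        have h1 : w p = x (w p) := by
          simpa [sub_eq_zero] using hq
        have h2 : p = x (w p) := by
          have := congrArg r h1
          rwa [hr, hrx] at this
        rw [h2, hx, ← h2] at hxp
        exact hxp
      · rintro _ ⟨q, hq, rfl⟩ ⟨p, -, hp⟩
        have hrq : r q = 0 := hq
        have h1 : q = x q + w p - x (w p) := by
          have : w p - x (w p) = q - x q := hp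
          rw [add_sub_assoc, this]; abel
        have h2 : q = w (x q + p - x (w p)) := by
          rw [map_sub, map_add, hwx, hwx]; exact h1
        have h3 : q = 0 := by
          have h4 := congrArg r h2
          rw [hr, hrq] at h4
          rw [h2, ← h4, map_zero]
        rw [h3, map_zero]
    refine (Submodule.eq_bot_iff _).2 fun t ht => ?_
    have hmem : (1 - x) t ∈ (LinearMap.ker r).map (1 - x) := ⟨t, ht, rfl⟩
    rw [hP, Submodule.mem_bot] at hmem
    have htx : t = x t := by simpa [sub_eq_zero] using hmem
    rw [htx, ← hrx, ← htx]
    exact ht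
  refine ⟨⟨r, w, LinearMap.ext hr, LinearMap.ext (apply_apply_eq_of_leftInverse hr hrker)⟩,
    mem_essentialKernelIdeal_of_hull hg hess (fun n hn => ?_) fun v hv => ?_⟩
  · have : c n = 0 := hn
    simp [this]
  · have : w v = c v := by simp [hw, hv]
    have h2 : r (c v) = v := by rw [← this, hr]
    simp [h2]

/-- There is an idempotent `x` in the conductor of any subring containing all units, whose kernel
has no two disjoint nonzero isomorphic submodules. -/
lemma exists_idempotent_mem_conductor (hE : Module.Injective R E)
    (A : Subring (Module.End R E)) (hA : ∀ u : (Module.End R E)ˣ, (u : Module.End R E) ∈ A)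
    (hΔ : essentialKernelIdeal R E ≤ A.conductor) :
    ∃ x ∈ A.conductor, (∀ v, x (x v) = x v) ∧
      ∀ (P : Submodule R E) (h : Module.End R E), (∀ p ∈ P, x p = 0) →
        (∀ p ∈ P, x (h p) = 0) → (∀ p ∈ P, h p = 0 → p = 0) → Disjoint P (P.map h) → P = ⊥ := by
  obtain ⟨G, -, hG, hmax⟩ := zorn_le_nonempty₀
    {G : Submodule R (E × E) | ∀ p ∈ G, ∀ q ∈ G, p.1 = q.2 → p = 0 ∧ q = 0}
    (fun c hc hchain y hy => by
      refine ⟨sSup c, fun p hp q hq hpq => ?_, fun z hz => le_sSup hz⟩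
      obtain ⟨G₁, hG₁, hp⟩ := (Submodule.mem_sSup_of_directed ⟨y, hy⟩ hchain.directedOn).1 hp
      obtain ⟨G₂, hG₂, hq⟩ := (Submodule.mem_sSup_of_directed ⟨y, hy⟩ hchain.directedOn).1 hq
      obtain ⟨G₃, hG₃, h₁, h₂⟩ := hchain.directedOn G₁ hG₁ G₂ hG₂
      exact hc hG₃ p (h₁ hp) q (h₂ hq) hpq)
    ⊥ (fun p hp q hq _ => ⟨by simpa using hp, by simpa using hq⟩)
  have hG1 : ∀ p ∈ G, p.1 = 0 → p = 0 := fun p hp h => (hG p hp 0 G.zero_mem h).1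
  have hG2 : ∀ p ∈ G, p.2 = 0 → p = 0 := fun p hp h => (hG 0 G.zero_mem p hp h.symm).2
  let A₁ := G.map (LinearMap.fst R E E)
  let A₂ := G.map (LinearMap.snd R E E)
  have mem1 : ∀ p ∈ G, p.1 ∈ A₁ := fun p hp => ⟨p, hp, rfl⟩
  have mem2 : ∀ p ∈ G, p.2 ∈ A₂ := fun p hp => ⟨p, hp, rfl⟩
  have hdisj : Disjoint A₁ A₂ := by
    rw [Submodule.disjoint_def]
    rintro _ ⟨p, hp, rfl⟩ ⟨q, hq, h⟩
    simp [(hG p hp q hq h.symm).1]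
  obtain ⟨φ, hφ⟩ := hE.out (LinearMap.fst R E E ∘ₗ G.subtype)
    ((injective_iff_map_eq_zero _).2 fun p hp => Subtype.ext (hG1 p.1 p.2 hp))
    (LinearMap.snd R E E ∘ₗ G.subtype)
  obtain ⟨ψ, hψ⟩ := hE.out (LinearMap.snd R E E ∘ₗ G.subtype)
    ((injective_iff_map_eq_zero _).2 fun p hp => Subtype.ext (hG2 p.1 p.2 hp))
    (LinearMap.fst R E E ∘ₗ G.subtype)
  replace hφ : ∀ p ∈ G, φ p.1 = p.2 := fun p hp => hφ ⟨p, hp⟩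
  replace hψ : ∀ p ∈ G, ψ p.2 = p.1 := fun p hp => hψ ⟨p, hp⟩
  obtain ⟨e, he, eN, eD, eess⟩ := exists_idempotent_hull hE hdisj
  obtain ⟨f, hf, fN, fD, fess⟩ := exists_idempotent_hull hE hdisj.symm
  obtain ⟨x, hx, xN, -, xess⟩ :=
    exists_idempotent_hull hE (N := A₁ ⊔ A₂) (D := ⊥) disjoint_bot_right
  let n : Module.End R E := (1 - e) * φ * e
  have hn : n ∈ A.conductor := Subring.mem_conductor_of_idempotent hA (e := e)
    (LinearMap.ext he) (LinearMap.ext fun v => by simp [n, he])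
    (LinearMap.ext fun v => by simp [n, he])
  have hnG : ∀ p ∈ G, n p.1 = p.2 := fun p hp => by
    simp [n, eN _ (mem1 p hp), hφ p hp, eD _ (mem2 p hp)]
  have mem_of_sub : ∀ s t : Module.End R E, t ∈ A.conductor → t - s ∈ essentialKernelIdeal R E →
      s ∈ A.conductor := fun s t ht hts => by
    simpa using A.conductor.sub_mem ht (hΔ hts)
  have heA : e ∈ A.conductor := by
    refine mem_of_sub e (ψ * n) (A.conductor.mul_mem_left _ _ hn)
      (mem_essentialKernelIdeal_of_hull he eess ?_ fun v hv => by simp [n, hv])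
    rintro _ ⟨p, hp, rfl⟩
    simp [hnG p hp, hψ p hp, eN _ (mem1 p hp)]
  have hfA : f ∈ A.conductor := by
    refine mem_of_sub f (n * ψ * f)
      (A.conductor.mul_mem_right _ _ (A.conductor.mul_mem_right _ _ hn))
      (mem_essentialKernelIdeal_of_hull hf fess ?_ fun v hv => by simp [hv])
    rintro _ ⟨p, hp, rfl⟩
    simp [hnG p hp, hψ p hp, fN _ (mem2 p hp)]
  have hxA : x ∈ A.conductor := by
    refine mem_of_sub x ((e + f) * x)
      (A.conductor.mul_mem_right _ _ (A.conductor.add_mem heA hfA))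
      (mem_essentialKernelIdeal_of_hull hx xess ?_ fun v hv => by simp [hv])
    intro v hv
    have hxv := xN v hv
    obtain ⟨a, ha, b, hb, rfl⟩ := Submodule.mem_sup.1 hv
    simp [-map_add, hxv]
    simp [eN a ha, eD b hb, fN b hb, fD a ha]
  refine ⟨x, hxA, hx, fun P h hP hhP hinj hdis => ?_⟩
  let Γ := P.map (LinearMap.id.prod h)
  have hle : G ⊔ Γ ≤ G := by
    refine hmax ?_ le_sup_left
    intro p' hp' q' hq' heq
    obtain ⟨p, hp, _, ⟨r, hr, rfl⟩, rfl⟩ := Submodule.mem_sup.1 hp'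
    obtain ⟨q, hq, _, ⟨s, hs, rfl⟩, rfl⟩ := Submodule.mem_sup.1 hq'
    replace heq : p.1 + r = q.2 + h s := heq
    have h1 : p.1 - q.2 = h s - r := by
      rw [sub_eq_sub_iff_add_eq_add, heq, add_comm]
    have h2 : p.1 - q.2 = 0 := by
      rw [← xN (p.1 - q.2) (Submodule.sub_mem _ (Submodule.mem_sup_left (mem1 p hp))
        (Submodule.mem_sup_right (mem2 q hq))), h1, map_sub, hhP s hs, hP r hr, sub_zero]
    obtain ⟨rfl, rfl⟩ := hG p hp q hq (sub_eq_zero.1 h2)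
    rw [h2, eq_comm, sub_eq_zero] at h1
    have hr0 : r = 0 := Submodule.disjoint_def.1 hdis r hr ⟨s, hs, h1⟩
    have hs0 : s = 0 := hinj s hs (h1.trans hr0)
    simp [hr0, hs0]
  refine (Submodule.eq_bot_iff _).2 fun p hp => ?_
  have hmem : (p, h p) ∈ G := hle (Submodule.mem_sup_right ⟨p, hp, rfl⟩)
  rw [← xN p (Submodule.mem_sup_left (mem1 _ hmem)), hP p hp]

/-- A subring of the endomorphism ring of an injective module that contains all units is von Neumann
regular modulo the endomorphisms with essential kernel. -/
lemma Subring.exists_mul_mul_sub_mem_essentialKernelIdeal (hE : Module.Injective R E)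
    (A : Subring (Module.End R E)) (hA : ∀ u : (Module.End R E)ˣ, (u : Module.End R E) ∈ A)
    {a : Module.End R E} (ha : a ∈ A) :
    ∃ b ∈ A, a * b * a - a ∈ essentialKernelIdeal R E := by
  have hΔA : ∀ s ∈ essentialKernelIdeal R E, s ∈ A := fun s hs => by
    obtain ⟨u, hu⟩ := isUnit_one_sub_of_mem_essentialKernelIdeal hE hs
    have := A.sub_mem A.one_mem (hA u)
    rwa [hu, sub_sub_cancel] at this
  have hΔ : essentialKernelIdeal R E ≤ A.conductor := fun s hs =>
    Subring.mem_conductor.2 fun t t' => hΔA _ <|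
      TwoSidedIdeal.mul_mem_right _ _ _ (TwoSidedIdeal.mul_mem_left _ _ _ hs)
  obtain ⟨x, hxA, hx, habel⟩ := exists_idempotent_mem_conductor hE A hA hΔ
  let c := (1 - x) * a * (1 - x)
  obtain ⟨u, hu⟩ := exists_unit_mul_mul_sub_mem_essentialKernelIdeal hE (c := c) hx
    (fun v => by simp [c, hx]) (fun v => by simp [c, hx]) habel
  have hac : a - c ∈ A.conductor := by
    have : a - c = x * a + (1 - x) * a * x := by simp only [c]; noncomm_ring
    rw [this]
    exact A.conductor.add_mem (A.conductor.mul_mem_right _ _ hxA)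
      (A.conductor.mul_mem_left _ _ hxA)
  set y := a * u * a - a with hy
  have hyA : y ∈ A.conductor := by
    have : y = (c * u * c - c) + ((a - c) * (u * a) + c * u * (a - c) - (a - c)) := by
      rw [hy]; noncomm_ring
    rw [this]
    exact A.conductor.add_mem (hΔ hu) (A.conductor.sub_mem (A.conductor.add_mem
      (A.conductor.mul_mem_right _ _ hac) (A.conductor.mul_mem_left _ _ hac)) hac)
  obtain ⟨s, hs⟩ := _root_.exists_mul_mul_sub_mem_essentialKernelIdeal hE y
  refine ⟨u - (u * a - 1) * (s * y * s) * (a * u - 1), ?_, ?_⟩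
  · exact A.sub_mem (hA u) (A.mul_mem (A.mul_mem (A.sub_mem (A.mul_mem (hA u) ha) A.one_mem)
      (Subring.mem_conductor.1 hyA s s)) (A.sub_mem (A.mul_mem ha (hA u)) A.one_mem))
  · have h1 : a * (u - (u * a - 1) * (s * y * s) * (a * u - 1)) * a - a
        = y - y * (s * y * s) * y := by
      have h2 : a * (u * a - 1) = y := by rw [hy]; noncomm_ring
      have h3 : (a * u - 1) * a = y := by rw [hy]; noncomm_ring
      calc _ = (a * u * a - a) - (a * (u * a - 1)) * (s * y * s) * ((a * u - 1) * a) := by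
            noncomm_ring
        _ = _ := by rw [h2, h3]
    have h4 : y - y * (s * y * s) * y = -((y * s * y - y) * (s * y) + (y * s * y - y)) := by
      noncomm_ring
    rw [h1, h4]
    exact TwoSidedIdeal.neg_mem _ (TwoSidedIdeal.add_mem _
      (TwoSidedIdeal.mul_mem_right _ _ _ hs) hs)

end Injective

section Invariant

variable {R E : Type*} [Ring R] [AddCommGroup E] [Module R E]

/-- The subring of endomorphisms that leave a submodule invariant. -/
def Submodule.stabilizerSubring (M : Submodule R E) : Subring (Module.End R E) where
  carrier := {s | ∀ v ∈ M, s v ∈ M}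
  mul_mem' hs ht v hv := hs _ (ht v hv)
  one_mem' _ hv := hv
  add_mem' hs ht v hv := M.add_mem (hs v hv) (ht v hv)
  zero_mem' _ _ := M.zero_mem
  neg_mem' hs v hv := M.neg_mem (hs v hv)

/-- The restriction to `M` of an endomorphism that leaves `M` invariant. -/
def Submodule.endRestrict (M : Submodule R E) (s : Module.End R E)
    (hs : s ∈ M.stabilizerSubring) : Module.End R M :=
  LinearMap.restrict s hs

@[simp]
lemma Submodule.coe_endRestrict_apply (M : Submodule R E) (s : Module.End R E)
    (hs : s ∈ M.stabilizerSubring) (v : M) : (M.endRestrict s hs v : E) = s v :=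
  rfl

lemma Submodule.exists_extension_mem_stabilizerSubring (hE : Module.Injective R E)
    (M : Submodule R E) (f : Module.End R M) :
    ∃ s ∈ M.stabilizerSubring, ∀ v : M, s v = f v := by
  obtain ⟨s, hs⟩ := hE.out M.subtype M.subtype_injective (M.subtype ∘ₗ f)
  refine ⟨s, fun v hv => ?_, hs⟩
  rw [show s v = f ⟨v, hv⟩ from hs ⟨v, hv⟩]
  exact (f _).2

/-- The Jacobson radical of the endomorphism ring of an automorphism-invariant module contains the
restrictions of endomorphisms of the injective hull with essential kernel. -/
lemma mem_jacobson_of_mem_essentialKernelIdeal (hE : Module.Injective R E) {M : Submodule R E}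
    (hinv : ∀ u : (Module.End R E)ˣ, (u : Module.End R E) ∈ M.stabilizerSubring)
    {s : Module.End R E} (hs : s ∈ essentialKernelIdeal R E) {f : Module.End R M}
    (hf : ∀ v : M, s v = f v) : f ∈ Ideal.jacobson (⊥ : Ideal (Module.End R M)) := by
  rw [Ideal.mem_jacobson_iff]
  intro y
  obtain ⟨t, -, ht⟩ := M.exists_extension_mem_stabilizerSubring hE y
  obtain ⟨u, hu⟩ := isUnit_one_sub_of_mem_essentialKernelIdeal hE
    (TwoSidedIdeal.mul_mem_left _ (-t) s hs)
  refine ⟨M.endRestrict ↑u⁻¹ (hinv u⁻¹), ?_⟩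
  rw [Ideal.mem_bot]
  ext v
  have h : (↑u⁻¹ : Module.End R E) ((u : Module.End R E) v) = v := by
    rw [← Module.End.mul_apply, Units.inv_mul, Module.End.one_apply]
  have h2 : (u : Module.End R E) v = y (f v) + v := by
    rw [hu]; simp [hf, ht, add_comm]
  rw [h2, map_add] at h
  simpa [sub_eq_zero] using h

lemma mem_essentialKernelIdeal_of_mem_jacobson (hE : Module.Injective R E) {M : Submodule R E}
    (hess : IsEssential M)
    (hinv : ∀ u : (Module.End R E)ˣ, (u : Module.End R E) ∈ M.stabilizerSubring)
    {s : Module.End R E} {f : Module.End R M} (hf : ∀ v : M, s v = f v)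
    (hJ : f ∈ Ideal.jacobson (⊥ : Ideal (Module.End R M))) :
    s ∈ essentialKernelIdeal R E := by
  have hsM : s ∈ M.stabilizerSubring := fun v hv => by
    rw [show s v = f ⟨v, hv⟩ from hf ⟨v, hv⟩]
    exact (f _).2
  obtain ⟨b, hb, hab⟩ :=
    Subring.exists_mul_mul_sub_mem_essentialKernelIdeal hE M.stabilizerSubring hinv hsM
  let β : Module.End R M := M.endRestrict b hb
  obtain ⟨z, hz⟩ := Ideal.mem_jacobson_iff.1 hJ (-β)
  rw [Ideal.mem_bot] at hz
  rw [mem_essentialKernelIdeal] at hab ⊢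
  refine (hab.inf hess).mono fun v hv => ?_
  obtain ⟨hv1, hv2⟩ := hv
  have hv3 : s (b (s v)) = s v := by simpa [sub_eq_zero] using hv1
  have hbs : b (s v) ∈ M := hb _ (hsM v hv2)
  let w : M := ⟨b (s v), hbs⟩
  have hw : β (f w) = w := by
    apply Subtype.ext
    rw [M.coe_endRestrict_apply, ← hf]
    simp [w, hv3]
  have hz' := LinearMap.congr_fun hz w
  have hw0 : w = 0 := by simpa [hw] using hz'
  have : b (s v) = 0 := congrArg Subtype.val hw0
  rw [LinearMap.mem_ker, ← hv3, this, map_zero]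

end Invariant

/-- For an automorphism-invariant module M, End(M) is semiregular:
End(M)/J is von Neumann regular and idempotents lift modulo J. -/
theorem stmt5 {R E : Type*} [Ring R] [AddCommGroup E] [Module R E]
    (hE : Module.Injective R E) (M : Submodule R E)
    (hess : IsEssential M)
    (hinv : ∀ φ : E ≃ₗ[R] E, ∀ x ∈ M, φ x ∈ M) :
    (∀ a : Module.End R ↥M, ∃ b : Module.End R ↥M,
      a * b * a - a ∈ Ideal.jacobson (⊥ : Ideal (Module.End R ↥M))) ∧
    (∀ e' : Module.End R ↥M,
      e' * e' - e' ∈ Ideal.jacobson (⊥ : Ideal (Module.End R ↥M)) →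
      ∃ e : Module.End R ↥M, e * e = e ∧
        e - e' ∈ Ideal.jacobson (⊥ : Ideal (Module.End R ↥M))) := by
  have hA : ∀ u : (Module.End R E)ˣ, (u : Module.End R E) ∈ M.stabilizerSubring := fun u =>
    hinv (LinearMap.GeneralLinearGroup.generalLinearEquiv R E u)
  constructor
  · intro a
    obtain ⟨s, hs, hsa⟩ := M.exists_extension_mem_stabilizerSubring hE a
    obtain ⟨b, hb, hab⟩ :=
      Subring.exists_mul_mul_sub_mem_essentialKernelIdeal hE M.stabilizerSubring hA hs
    refine ⟨M.endRestrict b hb, mem_jacobson_of_mem_essentialKernelIdeal hE hA hab fun v => ?_⟩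
    have h := hsa (M.endRestrict b hb (a v))
    simp_all
  · intro e' he'
    obtain ⟨s, hs, hse⟩ := M.exists_extension_mem_stabilizerSubring hE e'
    have hidem : s * s - s ∈ essentialKernelIdeal R E :=
      mem_essentialKernelIdeal_of_mem_jacobson hE hess hA (fun v => by simp [hse]) he'
    obtain ⟨g, hg, hgs⟩ := exists_idempotent_sub_mem_essentialKernelIdeal hE hidem
    have hgM : g ∈ M.stabilizerSubring := by
      obtain ⟨u, hu⟩ := isUnit_one_sub_of_mem_essentialKernelIdeal hE hgs
      have := Subring.add_mem _ hs (Subring.sub_mem _ (Subring.one_mem _) (hA u))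
      rwa [hu, sub_sub_cancel, add_sub_cancel] at this
    refine ⟨M.endRestrict g hgM, ?_,
      mem_jacobson_of_mem_essentialKernelIdeal hE hA hgs fun v => ?_⟩
    · ext v
      exact LinearMap.congr_fun hg (v : E)
    · simp [hse]
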